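/- Let E be an open subset of EuclideanSpace ℝ (Fin q), let B : E → ((EuclideanSpace ℝ (Fin k)) →ₗ[ℝ] (EuclideanSpace ℝ (Fin q))) be continuously differentiable, and let A y (t, λ) = B y t + λ • y as usual. Suppose at a point y₀ ∈ E the bilinear map (ξ, w) ↦ (fderiv ℝ A y₀ ξ) w is nonsingular. Then there exists an open neighborhood N ⊆ E of y₀ such that for all distinct x, y ∈ N the kernel of A x − A y is trivial; consequently the affine planes P_x, x ∈ N, are pairwise skew. (A nondegenerate fibration is locally skew.) -/

import Mathlib

open Metric Module

/-- The affine `k`-plane `P_y = {(t, B y t + y) : t}` associated to a map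
`B` into the space of linear maps. -/
noncomputable def plane {q k : ℕ}
    (B : EuclideanSpace ℝ (Fin q) → (EuclideanSpace ℝ (Fin k) →ₗ[ℝ] EuclideanSpace ℝ (Fin q)))
    (y : EuclideanSpace ℝ (Fin q)) :
    AffineSubspace ℝ (EuclideanSpace ℝ (Fin k) × EuclideanSpace ℝ (Fin q)) :=
  AffineSubspace.mk' (0, y) (LinearMap.graph (B y))

/-- The linear map `A y : (t, λ) ↦ B y t + λ • y`, as a continuous linear map. -/
noncomputable def Amap {q k : ℕ}
    (B : EuclideanSpace ℝ (Fin q) → (EuclideanSpace ℝ (Fin k) →ₗ[ℝ] EuclideanSpace ℝ (Fin q)))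
    (y : EuclideanSpace ℝ (Fin q)) :
    (EuclideanSpace ℝ (Fin k) × ℝ) →L[ℝ] EuclideanSpace ℝ (Fin q) :=
  LinearMap.toContinuousLinearMap
    ((B y).comp (LinearMap.fst ℝ (EuclideanSpace ℝ (Fin k)) ℝ) +
      (LinearMap.snd ℝ (EuclideanSpace ℝ (Fin k)) ℝ).smulRight y)

/-- A nonsingular bilinear map between finite-dimensional spaces is bounded below by a positive
multiple of the product of the norms. -/
theorem exists_pos_mul_norm_le_of_nonsingular {V W Z : Type*}
    [NormedAddCommGroup V] [NormedSpace ℝ V] [FiniteDimensional ℝ V]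
    [NormedAddCommGroup W] [NormedSpace ℝ W] [FiniteDimensional ℝ W]
    [NormedAddCommGroup Z] [NormedSpace ℝ Z]
    (L : V →L[ℝ] W →L[ℝ] Z) (hL : ∀ v w, L v w = 0 → v = 0 ∨ w = 0) :
    ∃ c : ℝ, 0 < c ∧ ∀ v w, c * (‖v‖ * ‖w‖) ≤ ‖L v w‖ := by
  have : ProperSpace V := FiniteDimensional.proper ℝ V
  have : ProperSpace W := FiniteDimensional.proper ℝ W
  obtain ⟨c, hc, hle⟩ := ((isCompact_sphere (0 : V) 1).prod
    (isCompact_sphere (0 : W) 1)).exists_forall_le' (f := fun p => ‖L p.1 p.2‖) (a := 0)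
    (by fun_prop) (by
      rintro ⟨v, w⟩ ⟨hv, hw⟩
      rw [mem_sphere_zero_iff_norm] at hv hw
      refine norm_pos_iff.2 fun h => ?_
      rcases hL _ _ h with h | h <;> simp_all)
  refine ⟨c, hc, fun v w => ?_⟩
  rcases eq_or_ne v 0 with rfl | hv
  · simp
  rcases eq_or_ne w 0 with rfl | hw
  · simp
  have hv' := norm_pos_iff.2 hv
  have hw' := norm_pos_iff.2 hw
  have h := hle (‖v‖⁻¹ • v, ‖w‖⁻¹ • w)
    ⟨by simp [norm_smul, hv'.ne'], by simp [norm_smul, hw'.ne']⟩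
  simp only [map_smul, smul_apply, norm_smul, norm_inv, norm_norm] at h
  calc c * (‖v‖ * ‖w‖) ≤ (‖w‖⁻¹ * (‖v‖⁻¹ * ‖L v w‖)) * (‖v‖ * ‖w‖) := by
        gcongr
    _ = ‖L v w‖ := by field_simp

/-- If the strict derivative of a family of linear maps is nonsingular at a point, then the
differences of distinct nearby members of the family are injective. -/
theorem HasStrictFDerivAt.eventually_sub_injective {V W Z : Type*}
    [NormedAddCommGroup V] [NormedSpace ℝ V] [FiniteDimensional ℝ V]
    [NormedAddCommGroup W] [NormedSpace ℝ W] [FiniteDimensional ℝ W]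
    [NormedAddCommGroup Z] [NormedSpace ℝ Z]
    {A : V → W →L[ℝ] Z} {L : V →L[ℝ] W →L[ℝ] Z} {v₀ : V} (hA : HasStrictFDerivAt A L v₀)
    (hL : ∀ v w, L v w = 0 → v = 0 ∨ w = 0) :
    ∀ᶠ p in nhds (v₀, v₀), p.1 ≠ p.2 → ∀ w, A p.1 w - A p.2 w = 0 → w = 0 := by
  obtain ⟨c, hc, hle⟩ := exists_pos_mul_norm_le_of_nonsingular L hL
  filter_upwards [hA.isLittleO.def (half_pos hc)] with p hp hne w hw
  by_contra hw0
  have hpos : 0 < ‖p.1 - p.2‖ * ‖w‖ :=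
    mul_pos (norm_pos_iff.2 (sub_ne_zero.2 hne)) (norm_pos_iff.2 hw0)
  have h : ‖L (p.1 - p.2) w‖ ≤ c / 2 * (‖p.1 - p.2‖ * ‖w‖) := by
    calc ‖L (p.1 - p.2) w‖ = ‖(A p.1 - A p.2 - L (p.1 - p.2)) w‖ := by
          rw [sub_apply, sub_apply, hw, zero_sub, norm_neg]
      _ ≤ ‖A p.1 - A p.2 - L (p.1 - p.2)‖ * ‖w‖ := ContinuousLinearMap.le_opNorm _ _
      _ ≤ c / 2 * ‖p.1 - p.2‖ * ‖w‖ := by gcongr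
      _ = c / 2 * (‖p.1 - p.2‖ * ‖w‖) := by ring
  nlinarith [hle (p.1 - p.2) w]

section

variable {q k : ℕ}
  {B : EuclideanSpace ℝ (Fin q) → (EuclideanSpace ℝ (Fin k) →ₗ[ℝ] EuclideanSpace ℝ (Fin q))}

@[simp]
theorem Amap_apply (y : EuclideanSpace ℝ (Fin q)) (t : EuclideanSpace ℝ (Fin k)) (lam : ℝ) :
    Amap B y (t, lam) = B y t + lam • y := by
  simp [Amap]

theorem contDiffAt_Amap {n : WithTop ℕ∞} {y : EuclideanSpace ℝ (Fin q)}
    (hB : ContDiffAt ℝ n (fun y => LinearMap.toContinuousLinearMap (B y)) y) :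
    ContDiffAt ℝ n (Amap B) y := by
  have h : Amap B = fun y => (LinearMap.toContinuousLinearMap (B y)).comp
      (ContinuousLinearMap.fst ℝ (EuclideanSpace ℝ (Fin k)) ℝ) +
      ContinuousLinearMap.smulRightL ℝ _ _
        (ContinuousLinearMap.snd ℝ (EuclideanSpace ℝ (Fin k)) ℝ) y := by
    funext y
    refine ContinuousLinearMap.ext fun p => ?_
    obtain ⟨t, lam⟩ := p
    simp
  rw [h]
  exact (hB.clm_comp contDiffAt_const).add (ContinuousLinearMap.contDiff _).contDiffAt

theorem mem_plane_iff {y : EuclideanSpace ℝ (Fin q)}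
    {p : EuclideanSpace ℝ (Fin k) × EuclideanSpace ℝ (Fin q)} :
    p ∈ plane B y ↔ p.2 = B y p.1 + y := by
  simp [plane, AffineSubspace.mem_mk', LinearMap.mem_graph_iff, sub_eq_iff_eq_add]

theorem mem_direction_plane_iff {y : EuclideanSpace ℝ (Fin q)}
    {p : EuclideanSpace ℝ (Fin k) × EuclideanSpace ℝ (Fin q)} :
    p ∈ (plane B y).direction ↔ p.2 = B y p.1 := by
  simp [plane, LinearMap.mem_graph_iff]

end

theorem nondegenerate_implies_locally_skew (q k : ℕ)
    (E : Set (EuclideanSpace ℝ (Fin q))) (hE : IsOpen E)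
    (B : EuclideanSpace ℝ (Fin q) → (EuclideanSpace ℝ (Fin k) →ₗ[ℝ] EuclideanSpace ℝ (Fin q)))
    (hB : ContDiffOn ℝ 1 (fun y => LinearMap.toContinuousLinearMap (B y)) E)
    (y₀ : EuclideanSpace ℝ (Fin q)) (hy₀ : y₀ ∈ E)
    (hnonsing : ∀ (ξ : EuclideanSpace ℝ (Fin q)) (w : EuclideanSpace ℝ (Fin k) × ℝ),
      (fderiv ℝ (Amap B) y₀) ξ w = 0 → ξ = 0 ∨ w = 0) :
    ∃ N : Set (EuclideanSpace ℝ (Fin q)), N ⊆ E ∧ IsOpen N ∧ y₀ ∈ N ∧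
      ∀ x ∈ N, ∀ y ∈ N, x ≠ y →
        (∀ (t : EuclideanSpace ℝ (Fin k)) (lam : ℝ),
          Amap B x (t, lam) - Amap B y (t, lam) = 0 → t = 0 ∧ lam = 0) ∧
        Disjoint (plane B x : Set (EuclideanSpace ℝ (Fin k) × EuclideanSpace ℝ (Fin q)))
          (plane B y : Set (EuclideanSpace ℝ (Fin k) × EuclideanSpace ℝ (Fin q))) ∧
        (plane B x).direction ⊓ (plane B y).direction = ⊥ := by
  obtain ⟨U, hU, hy₀U, hUinj⟩ : ∃ U : Set (EuclideanSpace ℝ (Fin q)), IsOpen U ∧ y₀ ∈ U ∧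
      ∀ x ∈ U, ∀ y ∈ U, x ≠ y → ∀ w, Amap B x w - Amap B y w = 0 → w = 0 := by
    have hA := (contDiffAt_Amap (hB.contDiffAt (hE.mem_nhds hy₀))).hasStrictFDerivAt one_ne_zero
    obtain ⟨U, hU, hy₀U, h⟩ := exists_nhds_square (hA.eventually_sub_injective hnonsing)
    exact ⟨U, hU, hy₀U, fun x hx y hy => h (Set.mk_mem_prod hx hy)⟩
  refine ⟨E ∩ U, Set.inter_subset_left, hE.inter hU, ⟨hy₀, hy₀U⟩, ?_⟩
  rintro x ⟨-, hx⟩ y ⟨-, hy⟩ hxy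
  have hinj (t : EuclideanSpace ℝ (Fin k)) (lam : ℝ)
      (h : Amap B x (t, lam) - Amap B y (t, lam) = 0) : t = 0 ∧ lam = 0 :=
    Prod.mk_eq_zero.1 (hUinj x hx y hy hxy (t, lam) h)
  refine ⟨hinj, Set.disjoint_left.2 fun p hpx hpy => ?_, (Submodule.eq_bot_iff _).2 ?_⟩
  · have h := (mem_plane_iff.1 hpx).symm.trans (mem_plane_iff.1 hpy)
    exact one_ne_zero (hinj p.1 1 (by simp [h])).2
  · rintro ⟨t, s⟩ ⟨htx, hty⟩
    have hsx : s = B x t := mem_direction_plane_iff.1 htx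
    have hsy : s = B y t := mem_direction_plane_iff.1 hty
    obtain rfl : t = 0 := (hinj t 0 (by simp [← hsx, ← hsy])).1
    simp [hsx]
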